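/- arXiv:2511.18971 — 2 statements merged into one kernel-verified Lean document; each statement's English description precedes it below -/
import Mathlib

section
/- For every real γ > 0, writing h₀ = h₀(γ), one has γ · f_dia(γ) / (γ·(γ·(h₀² − 1) + h₀) − 4)³ < 0, where f_dia(γ) = γ⁵·(h₀² − 1)³ + 4γ⁴·h₀·(h₀² − 1)² − 32γ²·h₀·(h₀² − 1) − 24γ·h₀² + γ³·(−4h₀⁴ + 11h₀² − 7) + 16h₀. (This quantity equals p·e_{pp} = p·(∂²e/∂p²)_η for the diatomic Synge energy, so the second pressure derivative of the diatomic Synge energy at constant entropy is strictly negative.) -/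
open MeasureTheory Real

/-- Modified Bessel function of the second kind of integer order `j`, via the integral
representation `K_j(γ) = (2^j j! / (2j)!) · γ^{-j} · ∫_γ^∞ e^{-λ} (λ² - γ²)^{j - 1/2} dλ`. -/
noncomputable def besselK (j : ℕ) (γ : ℝ) : ℝ :=
  ((2 : ℝ) ^ j * (Nat.factorial j) / (Nat.factorial (2 * j)) / γ ^ j) *
    ∫ l in Set.Ioi γ, Real.exp (-l) * (l ^ 2 - γ ^ 2) ^ ((j : ℝ) - 1 / 2)

/-- The ratio `h_i(γ) = K_i(γ)/K_{i+1}(γ)`. -/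
noncomputable def hRatio (i : ℕ) (γ : ℝ) : ℝ := besselK i γ / besselK (i + 1) γ

open Set Filter

/-- The weight `e^{-l} (l² - γ²)^{-1/2}` on `(γ, ∞)` whose moments are combinations of the modified
Bessel functions of the second kind. -/
noncomputable def besselWeight (γ l : ℝ) : ℝ := exp (-l) * (l ^ 2 - γ ^ 2) ^ (-(1 / 2) : ℝ)

/-- The `n`-th moment of `besselWeight γ` on `(γ, ∞)`. -/
noncomputable def besselMoment (γ : ℝ) (n : ℕ) : ℝ := ∫ l in Ioi γ, l ^ n * besselWeight γ l

lemma sq_sub_sq_pos_of_mem_Ioi {γ l : ℝ} (hγ : 0 < γ) (hl : l ∈ Ioi γ) : 0 < l ^ 2 - γ ^ 2 := by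
  have : γ < l := hl
  nlinarith

lemma besselWeight_pos {γ l : ℝ} (hγ : 0 < γ) (hl : l ∈ Ioi γ) : 0 < besselWeight γ l :=
  mul_pos (exp_pos _) (rpow_pos_of_pos (sq_sub_sq_pos_of_mem_Ioi hγ hl) _)

lemma continuousOn_besselWeight {γ : ℝ} (hγ : 0 < γ) : ContinuousOn (besselWeight γ) (Ioi γ) := by
  unfold besselWeight
  refine ContinuousOn.mul (by fun_prop) (ContinuousOn.rpow_const (by fun_prop) ?_)
  exact fun l hl => Or.inl (sq_sub_sq_pos_of_mem_Ioi hγ hl).ne'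

lemma integrableOn_sub_pow_mul_besselWeight {γ : ℝ} (hγ : 0 < γ) (m : ℕ) :
    IntegrableOn (fun l => (l - γ) ^ m * besselWeight γ l) (Ioi γ) := by
  have hgamma : IntegrableOn (fun s : ℝ => exp (-s) * s ^ ((m : ℝ) + 1 / 2 - 1)) (Ioi 0) :=
    GammaIntegral_convergent (by positivity)
  have hshift : IntegrableOn
      (fun l : ℝ => exp (-(l - γ)) * (l - γ) ^ ((m : ℝ) + 1 / 2 - 1)) (Ioi γ) := by
    have h := ((measurePreserving_sub_right volume γ).integrableOn_comp_preimage
      (MeasurableEquiv.subRight γ).measurableEmbedding).2 hgamma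
    rwa [preimage_sub_const_Ioi, zero_add] at h
  refine Integrable.mono' (hshift.mul_const ((2 * γ) ^ (-(1 / 2) : ℝ))) ?_ ?_
  · refine ContinuousOn.aestronglyMeasurable ?_ measurableSet_Ioi
    exact ContinuousOn.mul (by fun_prop) (continuousOn_besselWeight hγ)
  · refine (ae_restrict_iff' measurableSet_Ioi).2 (Eventually.of_forall fun l hl => ?_)
    have hs : 0 < l - γ := sub_pos.2 hl
    rw [norm_of_nonneg (mul_nonneg (by positivity) (besselWeight_pos hγ hl).le), besselWeight,
      show l ^ 2 - γ ^ 2 = (l - γ) * (l + γ) by ring,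
      mul_rpow hs.le (by linarith), show (m : ℝ) + 1 / 2 - 1 = m + -(1 / 2) by ring,
      rpow_add hs, rpow_natCast]
    have h1 : (l + γ) ^ (-(1 / 2) : ℝ) ≤ (2 * γ) ^ (-(1 / 2) : ℝ) :=
      rpow_le_rpow_of_nonpos (by positivity) (by linarith) (by norm_num)
    have h0 : 0 ≤ (l + γ) ^ (-(1 / 2) : ℝ) := rpow_nonneg (by linarith) _
    have h2 : exp (-l) ≤ exp (-(l - γ)) := exp_le_exp.2 (by linarith)
    calc (l - γ) ^ m * (exp (-l) * ((l - γ) ^ (-(1 / 2) : ℝ) * (l + γ) ^ (-(1 / 2) : ℝ)))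
        = exp (-l) * ((l - γ) ^ m * (l - γ) ^ (-(1 / 2) : ℝ)) * (l + γ) ^ (-(1 / 2) : ℝ) := by ring
      _ ≤ _ := by gcongr

lemma integrableOn_pow_mul_besselWeight {γ : ℝ} (hγ : 0 < γ) (n : ℕ) :
    IntegrableOn (fun l => l ^ n * besselWeight γ l) (Ioi γ) := by
  suffices h : ∀ m : ℕ, IntegrableOn (fun l => l ^ n * ((l - γ) ^ m * besselWeight γ l)) (Ioi γ) by
    simpa using h 0
  induction n with
  | zero => simpa using integrableOn_sub_pow_mul_besselWeight hγ
  | succ n ih =>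
    intro m
    refine ((ih (m + 1)).add ((ih m).const_mul γ)).congr (Eventually.of_forall fun l => ?_)
    simp only [Pi.add_apply]
    ring

lemma rpow_one_half_eq_mul {x : ℝ} (hx : 0 < x) :
    x ^ (1 / 2 : ℝ) = x * x ^ (-(1 / 2) : ℝ) := by
  rw [← rpow_one_add' hx.le (by norm_num)]
  norm_num

lemma hasDerivAt_pow_mul_exp_mul_rpow {γ l : ℝ} (hγ : 0 < γ) (hl : l ∈ Ioi γ) (n : ℕ) :
    HasDerivAt (fun x => x ^ n * (exp (-x) * (x ^ 2 - γ ^ 2) ^ (1 / 2 : ℝ)))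
      ((n * l ^ (n - 1) * (l ^ 2 - γ ^ 2) - l ^ n * (l ^ 2 - γ ^ 2) + l ^ (n + 1))
        * besselWeight γ l) l := by
  have hpos := sq_sub_sq_pos_of_mem_Ioi hγ hl
  have hexp : HasDerivAt (fun x : ℝ => exp (-x)) (-exp (-l)) l := by
    simpa using (hasDerivAt_neg l).exp
  have hroot : HasDerivAt (fun x : ℝ => (x ^ 2 - γ ^ 2) ^ (1 / 2 : ℝ))
      (l * (l ^ 2 - γ ^ 2) ^ (-(1 / 2) : ℝ)) l := by
    have h := ((hasDerivAt_pow 2 l).sub_const (γ ^ 2)).rpow_const (p := 1 / 2) (Or.inl hpos.ne')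
    refine h.congr_deriv ?_
    rw [show (1 / 2 : ℝ) - 1 = -(1 / 2) by norm_num]
    push_cast
    ring
  refine ((hasDerivAt_pow n l).mul (hexp.mul hroot)).congr_deriv ?_
  simp only [Pi.mul_apply, besselWeight, rpow_one_half_eq_mul hpos]
  ring

lemma integral_moment_derivative_eq_zero {γ : ℝ} (hγ : 0 < γ) (n : ℕ) :
    ∫ l in Ioi γ, (n * l ^ (n - 1) * (l ^ 2 - γ ^ 2) - l ^ n * (l ^ 2 - γ ^ 2) + l ^ (n + 1))
        * besselWeight γ l = 0 := by
  have hmom := integrableOn_pow_mul_besselWeight hγ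
  have hderiv : IntegrableOn (fun l : ℝ =>
      (n * l ^ (n - 1) * (l ^ 2 - γ ^ 2) - l ^ n * (l ^ 2 - γ ^ 2) + l ^ (n + 1))
        * besselWeight γ l) (Ioi γ) := by
    refine (((((hmom (n - 1 + 2)).sub ((hmom (n - 1)).const_mul (γ ^ 2))).const_mul (n : ℝ)).sub
      ((hmom (n + 2)).sub ((hmom n).const_mul (γ ^ 2)))).add (hmom (n + 1))).congr
      (Eventually.of_forall fun l => ?_)
    simp only [Pi.add_apply, Pi.sub_apply]
    ring
  have hprim : IntegrableOn
      (fun x : ℝ => x ^ n * (exp (-x) * (x ^ 2 - γ ^ 2) ^ (1 / 2 : ℝ))) (Ioi γ) := by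
    refine ((hmom (n + 2)).sub ((hmom n).const_mul (γ ^ 2))).congr
      ((ae_restrict_iff' measurableSet_Ioi).2 (Eventually.of_forall fun l hl => ?_))
    simp only [Pi.sub_apply, besselWeight,
      rpow_one_half_eq_mul (sq_sub_sq_pos_of_mem_Ioi hγ hl)]
    ring
  have hd := fun l (hl : l ∈ Ioi γ) => hasDerivAt_pow_mul_exp_mul_rpow hγ hl n
  have hlim := tendsto_zero_of_hasDerivAt_of_integrableOn_Ioi hd hderiv hprim
  have hcont : Continuous
      (fun x : ℝ => x ^ n * (exp (-x) * (x ^ 2 - γ ^ 2) ^ (1 / 2 : ℝ))) := by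
    refine Continuous.mul (by fun_prop) (Continuous.mul (by fun_prop) ?_)
    exact Continuous.rpow_const (by fun_prop) fun _ => Or.inr (by norm_num)
  rw [integral_Ioi_of_hasDerivAt_of_tendsto hcont.continuousWithinAt hd hderiv hlim]
  simp

lemma integrableOn_cubic_mul_besselWeight {γ : ℝ} (hγ : 0 < γ) (a b c d : ℝ) :
    IntegrableOn (fun l => (a * l ^ 3 + b * l ^ 2 + c * l + d) * besselWeight γ l) (Ioi γ) := by
  have hmom := integrableOn_pow_mul_besselWeight hγ
  refine (((((hmom 3).const_mul a).add ((hmom 2).const_mul b)).add ((hmom 1).const_mul c)).add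
    ((hmom 0).const_mul d)).congr (Eventually.of_forall fun l => ?_)
  simp only [Pi.add_apply]
  ring

lemma integral_cubic_mul_besselWeight {γ : ℝ} (hγ : 0 < γ) (a b c d : ℝ) :
    ∫ l in Ioi γ, (a * l ^ 3 + b * l ^ 2 + c * l + d) * besselWeight γ l
      = a * besselMoment γ 3 + b * besselMoment γ 2 + c * besselMoment γ 1
        + d * besselMoment γ 0 := by
  have hmom := integrableOn_pow_mul_besselWeight hγ
  unfold besselMoment
  rw [← integral_const_mul, ← integral_const_mul, ← integral_const_mul, ← integral_const_mul,
    ← integral_add' ((hmom 3).const_mul a) ((hmom 2).const_mul b),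
    ← integral_add' (((hmom 3).const_mul a).add ((hmom 2).const_mul b)) ((hmom 1).const_mul c),
    ← integral_add' ((((hmom 3).const_mul a).add ((hmom 2).const_mul b)).add
      ((hmom 1).const_mul c)) ((hmom 0).const_mul d)]
  congr 1 with l
  simp only [Pi.add_apply]
  ring

lemma besselMoment_two {γ : ℝ} (hγ : 0 < γ) :
    besselMoment γ 2 = γ ^ 2 * besselMoment γ 0 + besselMoment γ 1 := by
  have h := integral_moment_derivative_eq_zero hγ 0
  have h2 := integral_cubic_mul_besselWeight hγ 0 (-1) 1 (γ ^ 2)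
  have heq : ∀ l : ℝ, ((0 : ℕ) * l ^ (0 - 1) * (l ^ 2 - γ ^ 2) - l ^ 0 * (l ^ 2 - γ ^ 2)
      + l ^ (0 + 1)) = 0 * l ^ 3 + -1 * l ^ 2 + 1 * l + γ ^ 2 := fun l => by
    push_cast
    ring
  simp only [heq] at h
  linarith

lemma besselMoment_three {γ : ℝ} (hγ : 0 < γ) :
    besselMoment γ 3 = γ ^ 2 * besselMoment γ 0 + (γ ^ 2 + 2) * besselMoment γ 1 := by
  have h := integral_moment_derivative_eq_zero hγ 1
  have h2 := besselMoment_two hγ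
  have h3 := integral_cubic_mul_besselWeight hγ (-1) 2 (γ ^ 2) (-γ ^ 2)
  have heq : ∀ l : ℝ, ((1 : ℕ) * l ^ (1 - 1) * (l ^ 2 - γ ^ 2) - l ^ 1 * (l ^ 2 - γ ^ 2)
      + l ^ (1 + 1)) = -1 * l ^ 3 + 2 * l ^ 2 + γ ^ 2 * l + -γ ^ 2 := fun l => by
    push_cast
    ring
  simp only [heq] at h
  linarith

lemma setIntegral_Ioi_pos {f : ℝ → ℝ} {a c : ℝ} (hf : IntegrableOn f (Ioi a))
    (hpos : ∀ x ∈ Ioi a, x ≠ c → 0 < f x) (hc : c ∈ Ioi a → 0 ≤ f c) : 0 < ∫ x in Ioi a, f x := by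
  have hnonneg : ∀ x ∈ Ioi a, 0 ≤ f x := fun x hx => by
    rcases eq_or_ne x c with rfl | h
    exacts [hc hx, (hpos x hx h).le]
  rw [setIntegral_pos_iff_support_of_nonneg_ae
    ((ae_restrict_iff' measurableSet_Ioi).2 (Eventually.of_forall hnonneg)) hf]
  have hsub : Ioi (max a c) ⊆ Function.support f ∩ Ioi a := fun x hx => by
    have hx' := max_lt_iff.1 (mem_Ioi.1 hx)
    exact ⟨(hpos x hx'.1 hx'.2.ne').ne', hx'.1⟩
  exact lt_of_lt_of_le (by simp) (measure_mono hsub)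

lemma besselMoment_pos {γ : ℝ} (hγ : 0 < γ) (n : ℕ) : 0 < besselMoment γ n := by
  have hpos : ∀ l ∈ Ioi γ, 0 < l ^ n * besselWeight γ l := fun l hl =>
    mul_pos (pow_pos (hγ.trans hl) n) (besselWeight_pos hγ hl)
  exact setIntegral_Ioi_pos (c := γ) (integrableOn_pow_mul_besselWeight hγ n)
    (fun l hl _ => hpos l hl) fun h => (hpos γ h).le

lemma besselK_zero_eq (γ : ℝ) : besselK 0 γ = besselMoment γ 0 := by
  simp [besselK, besselMoment, besselWeight]

lemma besselK_one_eq {γ : ℝ} (hγ : 0 < γ) : besselK 1 γ = besselMoment γ 1 / γ := by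
  have hmom := integrableOn_pow_mul_besselWeight hγ
  have h : ∫ l in Ioi γ, exp (-l) * (l ^ 2 - γ ^ 2) ^ (((1 : ℕ) : ℝ) - 1 / 2)
      = besselMoment γ 2 - γ ^ 2 * besselMoment γ 0 := by
    unfold besselMoment
    rw [← integral_const_mul, ← integral_sub (hmom 2) ((hmom 0).const_mul _)]
    refine setIntegral_congr_fun measurableSet_Ioi fun l hl => ?_
    have hhalf := rpow_one_half_eq_mul (sq_sub_sq_pos_of_mem_Ioi hγ hl)
    simp only [besselWeight]
    rw [show ((1 : ℕ) : ℝ) - 1 / 2 = 1 / 2 by norm_num, hhalf]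
    ring
  rw [besselK, h, besselMoment_two hγ]
  simp [Nat.factorial]
  ring

lemma hRatio_zero_eq {γ : ℝ} (hγ : 0 < γ) :
    hRatio 0 γ = γ * besselMoment γ 0 / besselMoment γ 1 := by
  have := (besselMoment_pos hγ 1).ne'
  rw [hRatio, besselK_zero_eq, besselK_one_eq hγ]
  field_simp

/-- A cubic that is positive on `(γ, ∞)` except possibly at one point has a positive integral
against `besselWeight γ`. -/
lemma cubic_besselMoment_pos {γ : ℝ} (hγ : 0 < γ) (a b c d : ℝ) {x : ℝ}
    (hpos : ∀ l ∈ Ioi γ, l ≠ x → 0 < a * l ^ 3 + b * l ^ 2 + c * l + d)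
    (hx : 0 ≤ a * x ^ 3 + b * x ^ 2 + c * x + d) :
    0 < a * besselMoment γ 3 + b * besselMoment γ 2 + c * besselMoment γ 1
      + d * besselMoment γ 0 := by
  rw [← integral_cubic_mul_besselWeight hγ]
  exact setIntegral_Ioi_pos (c := x) (integrableOn_cubic_mul_besselWeight hγ a b c d)
    (fun l hl hne => mul_pos (hpos l hl hne) (besselWeight_pos hγ hl))
    fun h => mul_nonneg hx (besselWeight_pos hγ h).le

/-- Positivity of `∫ (l - γ - 1/2)² dμ` for the measure with density `besselWeight γ`. -/
lemma lt_hRatio_zero {γ : ℝ} (hγ : 0 < γ) :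
    8 * γ ^ 2 < hRatio 0 γ * (8 * γ ^ 2 + 4 * γ + 1) := by
  have h := cubic_besselMoment_pos hγ 0 1 (-(2 * γ + 1)) ((γ + 1 / 2) ^ 2) (x := γ + 1 / 2)
    (fun l _ hne => by linarith [sq_pos_of_ne_zero (sub_ne_zero.2 hne)])
    (le_of_eq (by ring))
  rw [besselMoment_two hγ] at h
  rw [hRatio_zero_eq hγ, div_mul_eq_mul_div, lt_div_iff₀ (besselMoment_pos hγ 1)]
  linarith [mul_pos hγ h]

/-- Positivity of `∫ (l - γ) (l - γ - 3/2)² dμ` for the measure with density `besselWeight γ`. -/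
lemma hRatio_zero_lt {γ : ℝ} (hγ : 0 < γ) :
    hRatio 0 γ * (16 * γ ^ 2 + 20 * γ + 9) < 16 * γ ^ 2 + 12 * γ + 5 := by
  have h := cubic_besselMoment_pos hγ 1 (-(3 * γ + 3))
    ((γ + 3 / 2) ^ 2 + 2 * γ * (γ + 3 / 2)) (-(γ * (γ + 3 / 2) ^ 2)) (x := γ + 3 / 2)
    (fun l hl hne => by
      linarith [mul_pos (sub_pos.2 (mem_Ioi.1 hl)) (sq_pos_of_ne_zero (sub_ne_zero.2 hne))])
    (le_of_eq (by ring))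
  rw [besselMoment_three hγ, besselMoment_two hγ] at h
  rw [hRatio_zero_eq hγ, div_mul_eq_mul_div, div_lt_iff₀ (besselMoment_pos hγ 1)]
  linarith

/-- `p·e_{pp} < 0` for the diatomic Synge energy:
`γ f_dia(γ) / (γ(γ(h₀² − 1) + h₀) − 4)³ < 0` for all `γ > 0`. -/
theorem pepp_dia_neg (γ : ℝ) (hγ : 0 < γ) :
    γ * (γ ^ 5 * (hRatio 0 γ ^ 2 - 1) ^ 3
          + 4 * γ ^ 4 * hRatio 0 γ * (hRatio 0 γ ^ 2 - 1) ^ 2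
          - 32 * γ ^ 2 * hRatio 0 γ * (hRatio 0 γ ^ 2 - 1)
          - 24 * γ * hRatio 0 γ ^ 2
          + γ ^ 3 * (-4 * hRatio 0 γ ^ 4 + 11 * hRatio 0 γ ^ 2 - 7)
          + 16 * hRatio 0 γ)
      / (γ * (γ * (hRatio 0 γ ^ 2 - 1) + hRatio 0 γ) - 4) ^ 3 < 0 := by
  have hlow := lt_hRatio_zero hγ
  have hupp := hRatio_zero_lt hγ
  set h := hRatio 0 γ
  -- `h` is the weighted mediant of its two rational bounds with weights `1` and `t`.
  obtain ⟨t, ht, hh⟩ : ∃ t : ℝ, 0 < t ∧ h = (8 * γ ^ 2 + (16 * γ ^ 2 + 12 * γ + 5) * t)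
      / ((8 * γ ^ 2 + 4 * γ + 1) + (16 * γ ^ 2 + 20 * γ + 9) * t) := by
    have hb := sub_pos.2 hupp
    refine ⟨(h * (8 * γ ^ 2 + 4 * γ + 1) - 8 * γ ^ 2)
      / (16 * γ ^ 2 + 12 * γ + 5 - h * (16 * γ ^ 2 + 20 * γ + 9)),
      div_pos (sub_pos.2 hlow) hb, ?_⟩
    have hden : 0 < (8 * γ ^ 2 + 4 * γ + 1) + (16 * γ ^ 2 + 20 * γ + 9)
        * ((h * (8 * γ ^ 2 + 4 * γ + 1) - 8 * γ ^ 2)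
      / (16 * γ ^ 2 + 12 * γ + 5 - h * (16 * γ ^ 2 + 20 * γ + 9))) :=
      add_pos (by positivity) (mul_pos (by positivity) (div_pos (sub_pos.2 hlow) hb))
    rw [eq_div_iff hden.ne']
    have hb' := hb.ne'
    generalize hB : 16 * γ ^ 2 + 12 * γ + 5 - h * (16 * γ ^ 2 + 20 * γ + 9) = B at hb' ⊢
    field_simp
    rw [← hB]
    ring
  have hD : 0 < (8 * γ ^ 2 + 4 * γ + 1) + (16 * γ ^ 2 + 20 * γ + 9) * t := by positivity
  refine div_neg_of_pos_of_neg (mul_pos hγ ?_) (Odd.pow_neg (by decide) ?_)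
  · refine pos_of_mul_pos_left (b := ((8 * γ ^ 2 + 4 * γ + 1) + (16 * γ ^ 2 + 20 * γ + 9) * t) ^ 6)
      ?_ (by positivity)
    rw [hh]
    field_simp
    ring_nf
    positivity
  · rw [← neg_pos]
    refine pos_of_mul_pos_left (b := ((8 * γ ^ 2 + 4 * γ + 1) + (16 * γ ^ 2 + 20 * γ + 9) * t) ^ 2)
      ?_ (by positivity)
    rw [hh]
    field_simp
    ring_nf
    positivity
end

section
/- For every real γ > 0, one has γ·(K₁(γ)/K₂(γ))³ + 4·(K₁(γ)/K₂(γ))² − γ·(K₁(γ)/K₂(γ)) − 1 < 0. -/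
open MeasureTheory Real

open Filter Topology Set

section Barrier

/-- A function on `(0, ∞)` with positive derivative that vanishes at infinity is negative. -/
theorem neg_of_deriv_pos_of_tendsto_zero {F F' : ℝ → ℝ}
    (hF : ∀ x, 0 < x → HasDerivAt F (F' x) x) (hF' : ∀ x, 0 < x → 0 < F' x)
    (hlim : Tendsto F atTop (𝓝 0)) {x : ℝ} (hx : 0 < x) : F x < 0 := by
  have hmono : StrictMonoOn F (Ioi 0) := by
    refine strictMonoOn_of_deriv_pos (convex_Ioi 0)
      (fun y hy => (hF y hy).continuousAt.continuousWithinAt) fun y hy => ?_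
    rw [interior_Ioi] at hy
    rw [(hF y hy).deriv]
    exact hF' y hy
  have hx1 : 0 < x + 1 := by linarith
  have h1 : F x < F (x + 1) := hmono hx hx1 (by linarith)
  have h2 : F (x + 1) ≤ 0 := by
    refine ge_of_tendsto hlim ?_
    filter_upwards [eventually_ge_atTop (x + 1)] with y hy
    exact hmono.monotoneOn hx1 (lt_of_lt_of_le hx1 hy) hy
  linarith

variable {f g : ℝ → ℝ}

/-- Polynomially weighted products of rapidly decaying functions vanish at infinity. -/
theorem tendsto_pow_mul_mul_zero (hf : ∀ n : ℕ, Tendsto (fun x => x ^ n * f x) atTop (𝓝 0))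
    (hg : ∀ n : ℕ, Tendsto (fun x => x ^ n * g x) atTop (𝓝 0)) (n : ℕ) :
    Tendsto (fun x => x ^ n * (f x * g x)) atTop (𝓝 0) := by
  have h := (hf n).mul (hg 0)
  simp only [pow_zero, one_mul, mul_zero] at h
  exact h.congr fun x => by ring

/-- A cubic inequality between positive, rapidly decaying solutions of the differential system
satisfied by `K₁` and `K₂`. -/
theorem cubic_neg_of_bessel_system
    (hf : ∀ x, 0 < x → HasDerivAt f (-g x + f x / x) x)
    (hg : ∀ x, 0 < x → HasDerivAt g (-f x - 2 * g x / x) x)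
    (hf0 : ∀ x, 0 < x → 0 < f x) (hg0 : ∀ x, 0 < x → 0 < g x)
    (hfl : ∀ n : ℕ, Tendsto (fun x => x ^ n * f x) atTop (𝓝 0))
    (hgl : ∀ n : ℕ, Tendsto (fun x => x ^ n * g x) atTop (𝓝 0)) {x : ℝ} (hx : 0 < x) :
    x * f x ^ 3 + 4 * f x ^ 2 * g x - x * f x * g x ^ 2 - g x ^ 3 < 0 := by
  have hff := tendsto_pow_mul_mul_zero hfl hfl
  have hfg := tendsto_pow_mul_mul_zero hfl hgl
  have hgg := tendsto_pow_mul_mul_zero hgl hgl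
  have lower : ∀ x, 0 < x →
      -(x ^ 2 * f x ^ 2 + 12 * x * f x * g x + (24 - x ^ 2) * g x ^ 2) < 0 := by
    intro x hx
    refine neg_of_deriv_pos_of_tendsto_zero
      (F := fun x => -(x ^ 2 * f x ^ 2 + 12 * x * f x * g x + (24 - x ^ 2) * g x ^ 2))
      (F' := fun x => 8 * x * f x ^ 2 + 48 * f x * g x + (10 * x + 96 / x) * g x ^ 2)
      ?_ ?_ ?_ hx
    · intro y hy
      have hid := hasDerivAt_id' y
      refine ((((hid.pow 2).mul ((hf y hy).pow 2)).add
        (((hid.const_mul 12).mul (hf y hy)).mul (hg y hy))).add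
        (((hid.pow 2).const_sub 24).mul ((hg y hy).pow 2))).neg.congr_deriv ?_
      simp only [Pi.pow_apply, Pi.mul_apply]
      field_simp
      ring
    · intro y hy
      have := hf0 y hy
      have := hg0 y hy
      positivity
    · have h := (((hff 2).add ((hfg 1).const_mul 12)).add
        (((hgg 0).const_mul 24).sub (hgg 2))).neg
      simp only [mul_zero, add_zero, sub_zero, neg_zero] at h
      exact h.congr fun y => by ring
  have upper : ∀ x, 0 < x →
      x ^ 2 * f x ^ 2 + 3 * x * f x * g x - (x ^ 2 + 6) * g x ^ 2 < 0 := by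
    intro x hx
    refine neg_of_deriv_pos_of_tendsto_zero
      (F := fun x => x ^ 2 * f x ^ 2 + 3 * x * f x * g x - (x ^ 2 + 6) * g x ^ 2)
      (F' := fun x =>
        (x ^ 2 * f x ^ 2 + 12 * x * f x * g x + (24 - x ^ 2) * g x ^ 2) / x)
      ?_ ?_ ?_ hx
    · intro y hy
      have hid := hasDerivAt_id' y
      refine ((((hid.pow 2).mul ((hf y hy).pow 2)).add
        (((hid.const_mul 3).mul (hf y hy)).mul (hg y hy))).sub
        (((hid.pow 2).add_const 6).mul ((hg y hy).pow 2))).congr_deriv ?_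
      simp only [Pi.pow_apply, Pi.mul_apply]
      field_simp
      ring
    · intro y hy
      exact div_pos (by linarith [lower y hy]) hy
    · have h := ((hff 2).add ((hfg 1).const_mul 3)).sub
        ((hgg 2).add ((hgg 0).const_mul 6))
      simp only [mul_zero, add_zero, sub_zero] at h
      exact h.congr fun y => by ring
  refine neg_of_deriv_pos_of_tendsto_zero
    (F := fun x => x * f x ^ 3 + 4 * f x ^ 2 * g x - x * f x * g x ^ 2 - g x ^ 3)
    (F' := fun x =>
      g x * -(x ^ 2 * f x ^ 2 + 3 * x * f x * g x - (x ^ 2 + 6) * g x ^ 2) / x)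
    ?_ ?_ ?_ hx
  · intro y hy
    have hid := hasDerivAt_id' y
    refine ((((hid.mul ((hf y hy).pow 3)).add
      ((((hf y hy).pow 2).const_mul 4).mul (hg y hy))).sub
      ((hid.mul (hf y hy)).mul ((hg y hy).pow 2))).sub ((hg y hy).pow 3)).congr_deriv ?_
    simp only [Pi.pow_apply, Pi.mul_apply]
    field_simp
    ring
  · intro y hy
    exact div_pos (mul_pos (hg0 y hy) (by linarith [upper y hy])) hy
  · have h := (((tendsto_pow_mul_mul_zero hff hfl 1).add
      ((tendsto_pow_mul_mul_zero hff hgl 0).const_mul 4)).sub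
      (tendsto_pow_mul_mul_zero hfg hgl 1)).sub (tendsto_pow_mul_mul_zero hgg hgl 0)
    simp only [mul_zero, add_zero, sub_zero] at h
    exact h.congr fun y => by ring

end Barrier

section Laplace

/-- The Laplace transform of the restriction of `w` to `(1, ∞)`. -/
noncomputable def laplaceIoi (w : ℝ → ℝ) (γ : ℝ) : ℝ :=
  ∫ u in Ioi (1 : ℝ), Real.exp (-(γ * u)) * w u

variable {w v : ℝ → ℝ} {n : ℕ} {γ : ℝ}

theorem integrableOn_exp_mul_pow (hγ : 0 < γ) (n : ℕ) :
    IntegrableOn (fun u : ℝ => Real.exp (-(γ * u)) * u ^ n) (Ioi 1) := by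
  have h := (integrableOn_rpow_mul_exp_neg_mul_rpow (p := 1) (s := n) (b := γ)
    (by have : (0 : ℝ) ≤ n := n.cast_nonneg
        linarith) one_pos hγ).mono_set (Ioi_subset_Ioi (zero_le_one' ℝ))
  refine h.congr_fun (fun u _ => ?_) measurableSet_Ioi
  simp only [Real.rpow_one, Real.rpow_natCast, neg_mul]
  ring

theorem integrableOn_exp_mul (hw : Continuous w) (hwn : ∀ u, 1 < u → |w u| ≤ u ^ n)
    (hγ : 0 < γ) : IntegrableOn (fun u : ℝ => Real.exp (-(γ * u)) * w u) (Ioi 1) := by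
  refine (integrableOn_exp_mul_pow hγ n).mono'
    (by fun_prop : Continuous fun u : ℝ => Real.exp (-(γ * u)) * w u).aestronglyMeasurable ?_
  filter_upwards [ae_restrict_mem measurableSet_Ioi] with u hu
  rw [norm_mul, Real.norm_of_nonneg (Real.exp_pos _).le, Real.norm_eq_abs]
  exact mul_le_mul_of_nonneg_left (hwn u hu) (Real.exp_pos _).le

theorem laplaceIoi_pos (hw : Continuous w) (hwn : ∀ u, 1 < u → |w u| ≤ u ^ n)
    (hw0 : ∀ u, 1 < u → 0 < w u) (hγ : 0 < γ) : 0 < laplaceIoi w γ := by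
  refine (setIntegral_pos_iff_support_of_nonneg_ae ?_ (integrableOn_exp_mul hw hwn hγ)).2 ?_
  · filter_upwards [ae_restrict_mem measurableSet_Ioi] with u hu
    exact (mul_pos (Real.exp_pos _) (hw0 u hu)).le
  · have hsub : Ioi 1 ⊆ Function.support fun u => Real.exp (-(γ * u)) * w u :=
      fun u hu => (mul_pos (Real.exp_pos _) (hw0 u hu)).ne'
    rw [inter_eq_right.2 hsub]
    simp

theorem hasDerivAt_laplaceIoi (hw : Continuous w) (hwn : ∀ u, 1 < u → |w u| ≤ u ^ n)
    (hγ : 0 < γ) :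
    HasDerivAt (laplaceIoi w) (-laplaceIoi (fun u => u * w u) γ) γ := by
  have hγ2 : 0 < γ / 2 := by linarith
  have h := (hasDerivAt_integral_of_dominated_loc_of_deriv_le
    (μ := volume.restrict (Ioi (1 : ℝ)))
    (F := fun x u : ℝ => Real.exp (-(x * u)) * w u)
    (F' := fun x u : ℝ => -(Real.exp (-(x * u)) * (u * w u)))
    (bound := fun u => Real.exp (-(γ / 2 * u)) * u ^ (n + 1))
    (x₀ := γ) (s := Ioi (γ / 2)) (Ioi_mem_nhds (by linarith)) ?_
    (integrableOn_exp_mul hw hwn hγ) ?_ ?_ (integrableOn_exp_mul_pow hγ2 (n + 1)) ?_).2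
  · rwa [integral_neg] at h
  · exact Eventually.of_forall fun x =>
      (by fun_prop : Continuous fun u : ℝ => Real.exp (-(x * u)) * w u).aestronglyMeasurable
  · exact (by fun_prop :
      Continuous fun u : ℝ => -(Real.exp (-(γ * u)) * (u * w u))).aestronglyMeasurable
  · filter_upwards [ae_restrict_mem measurableSet_Ioi] with u hu x hx
    have hu0 : 0 < u := zero_lt_one.trans hu
    rw [norm_neg, norm_mul, Real.norm_of_nonneg (Real.exp_pos _).le, Real.norm_eq_abs, abs_mul,
      abs_of_pos hu0, pow_succ']
    refine mul_le_mul (Real.exp_le_exp.2 (neg_le_neg ?_))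
      (mul_le_mul_of_nonneg_left (hwn u hu) hu0.le) (by positivity) (Real.exp_pos _).le
    exact mul_le_mul_of_nonneg_right (le_of_lt hx) hu0.le
  · refine Eventually.of_forall fun u x _ => ?_
    refine (((hasDerivAt_id' x).mul_const u).fun_neg.exp.mul_const (w u)).congr_deriv ?_
    ring

/-- Integration by parts for `laplaceIoi`. -/
theorem mul_laplaceIoi_eq (hv : Continuous v) (hw : Continuous w) {m : ℕ} {C : ℝ}
    (hvn : ∀ u, 1 < u → |v u| ≤ u ^ n) (hwm : ∀ u, 1 < u → |w u| ≤ C * u ^ m) (hv1 : v 1 = 0)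
    (hvw : ∀ u, 1 < u → HasDerivAt v (w u) u) (hγ : 0 < γ) :
    γ * laplaceIoi v γ = laplaceIoi w γ := by
  have iv := integrableOn_exp_mul hv hvn hγ
  have iw : IntegrableOn (fun u : ℝ => Real.exp (-(γ * u)) * w u) (Ioi 1) := by
    refine ((integrableOn_exp_mul_pow hγ m).const_mul C).mono'
      (by fun_prop : Continuous fun u : ℝ => Real.exp (-(γ * u)) * w u).aestronglyMeasurable ?_
    filter_upwards [ae_restrict_mem measurableSet_Ioi] with u hu
    rw [norm_mul, Real.norm_of_nonneg (Real.exp_pos _).le, Real.norm_eq_abs, mul_left_comm]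
    exact mul_le_mul_of_nonneg_left (hwm u hu) (Real.exp_pos _).le
  have hlim : Tendsto (fun u : ℝ => Real.exp (-(γ * u)) * v u) atTop (𝓝 0) := by
    have h : Tendsto (fun u : ℝ => u ^ n * Real.exp (-(γ * u))) atTop (𝓝 0) := by
      have := tendsto_rpow_mul_exp_neg_mul_atTop_nhds_zero n γ hγ
      simpa using this
    refine squeeze_zero_norm' ?_ h
    filter_upwards [eventually_gt_atTop 1] with u hu
    rw [norm_mul, Real.norm_of_nonneg (Real.exp_pos _).le, Real.norm_eq_abs, mul_comm]
    exact mul_le_mul_of_nonneg_right (hvn u hu) (Real.exp_pos _).le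
  have h := integral_Ioi_of_hasDerivAt_of_tendsto (a := 1)
    (f := fun u : ℝ => Real.exp (-(γ * u)) * v u)
    (f' := fun u => Real.exp (-(γ * u)) * w u - γ * (Real.exp (-(γ * u)) * v u))
    (by fun_prop : Continuous fun u : ℝ => Real.exp (-(γ * u)) * v u).continuousWithinAt
    (fun u hu => ?_) (iw.sub (iv.const_mul γ)) hlim
  · rw [integral_sub iw (iv.const_mul γ), integral_const_mul, hv1, mul_zero, sub_zero] at h
    exact (sub_eq_zero.1 h).symm
  · refine ((((hasDerivAt_id' u).const_mul γ).fun_neg.exp).mul (hvw u hu)).congr_deriv ?_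
    ring

theorem tendsto_pow_mul_laplaceIoi (hw : Continuous w) (hwn : ∀ u, 1 < u → |w u| ≤ u ^ n)
    (hw0 : ∀ u, 1 < u → 0 < w u) (k : ℕ) :
    Tendsto (fun x => x ^ k * laplaceIoi w x) atTop (𝓝 0) := by
  have h : Tendsto (fun x : ℝ => x ^ k * Real.exp (-x) * (Real.exp 1 * laplaceIoi w 1))
      atTop (𝓝 0) := by
    simpa using (Real.tendsto_pow_mul_exp_neg_atTop_nhds_zero k).mul_const
      (Real.exp 1 * laplaceIoi w 1)
  refine squeeze_zero' ?_ ?_ h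
  · filter_upwards [eventually_gt_atTop 0] with x hx
    exact mul_nonneg (by positivity) (laplaceIoi_pos hw hwn hw0 hx).le
  · filter_upwards [eventually_ge_atTop 1] with x hx
    have hx0 : 0 < x := zero_lt_one.trans_le hx
    rw [mul_assoc]
    refine mul_le_mul_of_nonneg_left ?_ (by positivity)
    rw [← mul_assoc, ← Real.exp_add, laplaceIoi, laplaceIoi, ← integral_const_mul]
    refine setIntegral_mono_on (integrableOn_exp_mul hw hwn hx0)
      ((integrableOn_exp_mul hw hwn one_pos).const_mul _) measurableSet_Ioi fun u hu => ?_
    rw [← mul_assoc, ← Real.exp_add]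
    refine mul_le_mul_of_nonneg_right (Real.exp_le_exp.2 ?_) (hw0 u hu).le
    have hu1 : 1 < u := hu
    nlinarith [mul_nonneg (sub_nonneg.2 hx) (sub_nonneg.2 hu1.le)]

end Laplace

section Bessel

theorem sqrt_sq_sub_one_pos {u : ℝ} (hu : 1 < u) : 0 < √(u ^ 2 - 1) :=
  Real.sqrt_pos.2 (by nlinarith)

theorem abs_sqrt_sq_sub_one_pow_le (k : ℕ) {u : ℝ} (hu : 1 < u) :
    |√(u ^ 2 - 1) ^ k| ≤ u ^ k := by
  rw [abs_of_pos (pow_pos (sqrt_sq_sub_one_pos hu) k)]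
  exact pow_le_pow_left₀ (Real.sqrt_nonneg _)
    (Real.sqrt_le_iff.2 ⟨by linarith, by linarith⟩) k

theorem hasDerivAt_sqrt_sq_sub_one_pow_three {u : ℝ} (hu : 1 < u) :
    HasDerivAt (fun u : ℝ => √(u ^ 2 - 1) ^ 3) (3 * (u * √(u ^ 2 - 1))) u := by
  have hpos := sqrt_sq_sub_one_pos hu
  refine (((((hasDerivAt_id' u).pow 2).sub_const 1).sqrt (by
    simp only [Pi.pow_apply]; nlinarith)).pow 3).congr_deriv ?_
  simp only [Pi.pow_apply]
  norm_num
  field_simp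

/-- `K_j` as a Laplace transform over `(1, ∞)`. -/
theorem besselK_succ_eq (j : ℕ) {γ : ℝ} (hγ : 0 < γ) :
    besselK (j + 1) γ = 2 ^ (j + 1) * (j + 1).factorial / (2 * (j + 1)).factorial *
      (γ ^ (j + 1) * laplaceIoi (fun u => √(u ^ 2 - 1) ^ (2 * j + 1)) γ) := by
  have h := integral_comp_mul_left_Ioi
    (fun l => Real.exp (-l) * (l ^ 2 - γ ^ 2) ^ (((j + 1 : ℕ) : ℝ) - 1 / 2)) 1 hγ
  have hpt : ∀ u ∈ Ioi (1 : ℝ), Real.exp (-(γ * u)) *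
      ((γ * u) ^ 2 - γ ^ 2) ^ (((j + 1 : ℕ) : ℝ) - 1 / 2) =
      γ ^ (2 * j + 1) * (Real.exp (-(γ * u)) * √(u ^ 2 - 1) ^ (2 * j + 1)) := by
    intro u hu
    have hu1 : (1 : ℝ) < u := hu
    have hs := sqrt_sq_sub_one_pos hu1
    have hsq : √(u ^ 2 - 1) ^ 2 = u ^ 2 - 1 := Real.sq_sqrt (by nlinarith)
    have hbase : (γ * u) ^ 2 - γ ^ 2 = (γ * √(u ^ 2 - 1)) ^ (2 : ℝ) := by
      rw [Real.rpow_two]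
      linear_combination -γ ^ 2 * hsq
    have hexp : (2 : ℝ) * (((j + 1 : ℕ) : ℝ) - 1 / 2) = ((2 * j + 1 : ℕ) : ℝ) := by
      push_cast
      ring
    rw [hbase, ← Real.rpow_mul (by positivity), hexp, Real.rpow_natCast, mul_pow]
    ring
  rw [setIntegral_congr_fun measurableSet_Ioi hpt, integral_const_mul, mul_one,
    smul_eq_mul] at h
  have h' : ∫ l in Ioi γ, Real.exp (-l) * (l ^ 2 - γ ^ 2) ^ (((j + 1 : ℕ) : ℝ) - 1 / 2) =
      γ ^ (2 * (j + 1)) * laplaceIoi (fun u => √(u ^ 2 - 1) ^ (2 * j + 1)) γ := by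
    rw [laplaceIoi, show 2 * (j + 1) = 2 * j + 1 + 1 by ring, pow_succ' γ (2 * j + 1),
      mul_assoc, h, mul_inv_cancel_left₀ hγ.ne']
  rw [besselK, h']
  field_simp
  ring

theorem besselK_one_eq_s9 {γ : ℝ} (hγ : 0 < γ) :
    besselK 1 γ = γ * laplaceIoi (fun u => √(u ^ 2 - 1) ^ 1) γ := by
  have h := besselK_succ_eq 0 hγ
  norm_num [Nat.factorial] at h ⊢
  exact h

theorem besselK_two_eq {γ : ℝ} (hγ : 0 < γ) :
    besselK 2 γ = γ ^ 2 / 3 * laplaceIoi (fun u => √(u ^ 2 - 1) ^ 3) γ := by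
  have h := besselK_succ_eq 1 hγ
  norm_num [Nat.factorial] at h
  rw [h]
  ring

theorem continuous_sqrt_sq_sub_one_pow (k : ℕ) : Continuous fun u : ℝ => √(u ^ 2 - 1) ^ k := by
  fun_prop

theorem hasDerivAt_laplaceIoi_sqrt {γ : ℝ} (hγ : 0 < γ) :
    HasDerivAt (laplaceIoi fun u => √(u ^ 2 - 1) ^ 1)
      (-(γ / 3 * laplaceIoi (fun u => √(u ^ 2 - 1) ^ 3) γ)) γ := by
  refine (hasDerivAt_laplaceIoi (continuous_sqrt_sq_sub_one_pow 1)
    (fun u hu => abs_sqrt_sq_sub_one_pow_le 1 hu) hγ).congr_deriv ?_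
  have h := mul_laplaceIoi_eq (v := fun u => √(u ^ 2 - 1) ^ 3)
    (w := fun u => 3 * (u * √(u ^ 2 - 1))) (n := 3) (m := 2) (C := 3) (by fun_prop)
    (by fun_prop) (fun u hu => abs_sqrt_sq_sub_one_pow_le 3 hu) (fun u hu => ?_) (by simp)
    (fun u hu => hasDerivAt_sqrt_sq_sub_one_pow_three hu) hγ
  · have h3 : laplaceIoi (fun u => 3 * (u * √(u ^ 2 - 1))) γ =
        3 * laplaceIoi (fun u => u * √(u ^ 2 - 1) ^ 1) γ := by
      rw [laplaceIoi, laplaceIoi, ← integral_const_mul]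
      congr 1 with u
      ring
    linarith
  · have h1 := abs_sqrt_sq_sub_one_pow_le 1 hu
    rw [pow_one, pow_one] at h1
    rw [abs_mul, abs_mul, abs_of_pos (zero_lt_one.trans hu), abs_of_pos (by norm_num : (0:ℝ) < 3)]
    nlinarith

theorem hasDerivAt_laplaceIoi_sqrt_pow_three {γ : ℝ} (hγ : 0 < γ) :
    HasDerivAt (laplaceIoi fun u => √(u ^ 2 - 1) ^ 3)
      (-((3 * laplaceIoi (fun u => √(u ^ 2 - 1) ^ 1) γ +
        4 * laplaceIoi (fun u => √(u ^ 2 - 1) ^ 3) γ) / γ)) γ := by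
  refine (hasDerivAt_laplaceIoi (continuous_sqrt_sq_sub_one_pow 3)
    (fun u hu => abs_sqrt_sq_sub_one_pow_le 3 hu) hγ).congr_deriv ?_
  have h := mul_laplaceIoi_eq (v := fun u => u * √(u ^ 2 - 1) ^ 3)
    (w := fun u => 3 * √(u ^ 2 - 1) ^ 1 + 4 * √(u ^ 2 - 1) ^ 3) (n := 4) (m := 3) (C := 7)
    (by fun_prop) (by fun_prop) (fun u hu => ?_) (fun u hu => ?_) (by simp)
    (fun u hu => ?_) hγ
  · have h3 : laplaceIoi (fun u => 3 * √(u ^ 2 - 1) ^ 1 + 4 * √(u ^ 2 - 1) ^ 3) γ =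
        3 * laplaceIoi (fun u => √(u ^ 2 - 1) ^ 1) γ +
          4 * laplaceIoi (fun u => √(u ^ 2 - 1) ^ 3) γ := by
      have i1 := integrableOn_exp_mul (continuous_sqrt_sq_sub_one_pow 1)
        (fun u hu => abs_sqrt_sq_sub_one_pow_le 1 hu) hγ
      have i3 := integrableOn_exp_mul (continuous_sqrt_sq_sub_one_pow 3)
        (fun u hu => abs_sqrt_sq_sub_one_pow_le 3 hu) hγ
      rw [laplaceIoi, laplaceIoi, laplaceIoi, ← integral_const_mul, ← integral_const_mul,
        ← integral_add (i1.const_mul 3) (i3.const_mul 4)]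
      congr 1 with u
      ring
    rw [← h3, ← h, mul_div_cancel_left₀ _ hγ.ne']
  · rw [abs_mul, abs_of_pos (zero_lt_one.trans hu), pow_succ' u 3]
    exact mul_le_mul_of_nonneg_left (abs_sqrt_sq_sub_one_pow_le 3 hu) (zero_lt_one.trans hu).le
  · have h1 := (le_abs_self _).trans (abs_sqrt_sq_sub_one_pow_le 1 hu)
    have h3 := (le_abs_self _).trans (abs_sqrt_sq_sub_one_pow_le 3 hu)
    have hs := sqrt_sq_sub_one_pos hu
    have h13 : u ^ 1 ≤ u ^ 3 := pow_le_pow_right₀ hu.le (by norm_num)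
    rw [abs_of_pos (by positivity)]
    linarith
  · refine ((hasDerivAt_id' u).mul (hasDerivAt_sqrt_sq_sub_one_pow_three hu)).congr_deriv ?_
    have hsq : √(u ^ 2 - 1) ^ 2 = u ^ 2 - 1 := Real.sq_sqrt (by nlinarith)
    linear_combination (-3 * √(u ^ 2 - 1)) * hsq

end Bessel

/-- For every `γ > 0`, `γ(K₁/K₂)³ + 4(K₁/K₂)² − γ(K₁/K₂) − 1 < 0`. -/
theorem bessel_ratio_ineq2 (γ : ℝ) (hγ : 0 < γ) :
    γ * (besselK 1 γ / besselK 2 γ) ^ 3 + 4 * (besselK 1 γ / besselK 2 γ) ^ 2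
      - γ * (besselK 1 γ / besselK 2 γ) - 1 < 0 := by
  have pos (k : ℕ) {x : ℝ} (hx : 0 < x) : 0 < laplaceIoi (fun u => √(u ^ 2 - 1) ^ k) x :=
    laplaceIoi_pos (continuous_sqrt_sq_sub_one_pow k)
      (fun u hu => abs_sqrt_sq_sub_one_pow_le k hu)
      (fun u hu => pow_pos (sqrt_sq_sub_one_pos hu) k) hx
  have lim (k n : ℕ) : Tendsto (fun x => x ^ n * laplaceIoi (fun u => √(u ^ 2 - 1) ^ k) x)
      atTop (𝓝 0) :=
    tendsto_pow_mul_laplaceIoi (continuous_sqrt_sq_sub_one_pow k)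
      (fun u hu => abs_sqrt_sq_sub_one_pow_le k hu)
      (fun u hu => pow_pos (sqrt_sq_sub_one_pos hu) k) n
  have key := cubic_neg_of_bessel_system
    (f := fun x => x * laplaceIoi (fun u => √(u ^ 2 - 1) ^ 1) x)
    (g := fun x => x ^ 2 / 3 * laplaceIoi (fun u => √(u ^ 2 - 1) ^ 3) x)
    (fun x hx => ?_) (fun x hx => ?_) (fun x hx => mul_pos hx (pos 1 hx))
    (fun x hx => mul_pos (by positivity) (pos 3 hx)) (fun n => ?_) (fun n => ?_) hγ
  · have hK2 : 0 < besselK 2 γ := by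
      rw [besselK_two_eq hγ]
      exact mul_pos (by positivity) (pos 3 hγ)
    simp only [← besselK_one_eq_s9 hγ, ← besselK_two_eq hγ] at key
    have h := div_neg_of_neg_of_pos key (pow_pos hK2 3)
    refine lt_of_eq_of_lt ?_ h
    field_simp
  · refine ((hasDerivAt_id' x).mul (hasDerivAt_laplaceIoi_sqrt hx)).congr_deriv ?_
    field_simp
    ring
  · refine ((((hasDerivAt_id' x).pow 2).div_const 3).mul
      (hasDerivAt_laplaceIoi_sqrt_pow_three hx)).congr_deriv ?_
    simp only [Pi.pow_apply]
    field_simp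
    ring
  · exact (lim 1 (n + 1)).congr fun x => by ring
  · have h := (lim 3 (n + 2)).const_mul (1 / 3)
    rw [mul_zero] at h
    exact h.congr fun x => by ring
end
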